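/- Let d ≥ 3 be an integer, B ∈ ℝ, and θ > 1. Then the composition G_{θ,B} = F_{θ,B} ∘ F_{θ,B} has at most three fixed points in ℝ. -/

import Mathlib

open Set

/-- The anti-ferromagnetic Ising belief-propagation map in log-likelihood-ratio
coordinates: `F_{θ,B}(t) = 2B + (d-1) log((e^t + θ)/(θ e^t + 1))`. -/
noncomputable def isingF (d : ℕ) (θ B t : ℝ) : ℝ :=
  2 * B + ((d:ℝ) - 1) * Real.log ((Real.exp t + θ) / (θ * Real.exp t + 1))

/-- A real set with more than three elements contains an increasing quadruple. -/
lemma exists_lt_lt_lt_of_three_lt_encard {s : Set ℝ} (hs : 3 < s.encard) :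
    ∃ a ∈ s, ∃ b ∈ s, ∃ c ∈ s, ∃ e ∈ s, a < b ∧ b < c ∧ c < e := by
  obtain ⟨t, hts, ht⟩ := Set.exists_subset_encard_eq (s := s) (k := 4) (by
    have := Order.add_one_le_of_lt hs
    norm_num at this
    exact this)
  have hfin : t.Finite := Set.finite_of_encard_eq_coe (k := 4) (by exact_mod_cast ht)
  have hcard : hfin.toFinset.card = 4 := by
    rw [hfin.encard_eq_coe_toFinset_card] at ht
    exact_mod_cast ht
  let f := hfin.toFinset.orderEmbOfFin hcard
  have hf : ∀ i, f i ∈ s := fun i =>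
    hts (hfin.mem_toFinset.1 (hfin.toFinset.orderEmbOfFin_mem hcard i))
  exact ⟨f 0, hf 0, f 1, hf 1, f 2, hf 2, f 3, hf 3, f.strictMono (by decide),
    f.strictMono (by decide), f.strictMono (by decide)⟩

/-- Rolle's theorem for a function differentiable on the whole line. -/
lemma exists_deriv_zero_between {f f' : ℝ → ℝ} (hf : ∀ x, HasDerivAt f (f' x) x) {a b : ℝ}
    (hab : a < b) (h : f a = f b) : ∃ c, a < c ∧ c < b ∧ f' c = 0 := by
  obtain ⟨c, hc, h0⟩ := exists_hasDerivAt_eq_zero hab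
    (fun x _ => (hf x).continuousAt.continuousWithinAt) h (fun x _ => hf x)
  exact ⟨c, hc.1, hc.2, h0⟩

/-- If `F' = -k / w ^ 2` with `w > 0` and `w'' > 0` (that is, `F` has negative Schwarzian
derivative), then `F ∘ F` has at most three fixed points. -/
lemma encard_fixedPoints_comp_self_le_three {F w w₁ w₂ : ℝ → ℝ} {k : ℝ} (hk : 0 < k)
    (hw : ∀ x, 0 < w x) (hF : ∀ x, HasDerivAt F (-k / w x ^ 2) x)
    (h₁ : ∀ x, HasDerivAt w (w₁ x) x) (h₂ : ∀ x, HasDerivAt w₁ (w₂ x) x)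
    (hpos : ∀ x, 0 < w₂ x) : {t : ℝ | F (F t) = t}.encard ≤ 3 := by
  by_contra! hcon
  obtain ⟨a, ha, b, hb, c, hc, e, he, hab, hbc, hce⟩ := exists_lt_lt_lt_of_three_lt_encard hcon
  simp only [mem_ofPred_eq] at ha hb hc he
  have hG : ∀ x, HasDerivAt (fun t => F (F t) - t)
      (-k / w (F x) ^ 2 * (-k / w x ^ 2) - 1) x := fun x =>
    ((hF (F x)).comp x (hF x)).sub (hasDerivAt_id x)
  have hV : ∀ x, HasDerivAt (fun t => w t * w (F t))
      (w₁ x * w (F x) - k * w₁ (F x) / w x) x := fun x => by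
    have hwx := (hw x).ne'
    refine ((h₁ x).mul ((h₁ (F x)).comp x (hF x))).congr_deriv ?_
    simp only [Function.comp]
    field_simp
    ring
  have hV' : ∀ x, HasDerivAt (fun t => w₁ t * w (F t) - k * w₁ (F t) / w t)
      (w₂ x * w (F x) + k ^ 2 * w₂ (F x) / w x ^ 3) x := fun x => by
    have hwx := (hw x).ne'
    refine (((h₂ x).mul ((h₁ (F x)).comp x (hF x))).sub
      ((((h₂ (F x)).comp x (hF x)).const_mul k).div (h₁ x) hwx)).congr_deriv ?_
    simp only [Function.comp]
    field_simp
    ring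
  have hV_eq : ∀ x, -k / w (F x) ^ 2 * (-k / w x ^ 2) - 1 = 0 → w x * w (F x) = k := fun x hx => by
    have hwx := hw x
    have hwF := hw (F x)
    field_simp at hx
    have hsq : (w x * w (F x)) ^ 2 = k ^ 2 := by linarith
    exact (pow_left_inj₀ (mul_pos hwx hwF).le hk.le two_ne_zero).1 hsq
  obtain ⟨p, -, hpb, hp⟩ := exists_deriv_zero_between hG hab (by simp [ha, hb])
  obtain ⟨q, hbq, hqc, hq⟩ := exists_deriv_zero_between hG hbc (by simp [hb, hc])
  obtain ⟨r, hcr, -, hr⟩ := exists_deriv_zero_between hG hce (by simp [hc, he])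
  obtain ⟨u, -, huq, hu⟩ := exists_deriv_zero_between hV (hpb.trans hbq)
    ((hV_eq p hp).trans (hV_eq q hq).symm)
  obtain ⟨v, hqv, -, hv⟩ := exists_deriv_zero_between hV (hqc.trans hcr)
    ((hV_eq q hq).trans (hV_eq r hr).symm)
  obtain ⟨z, -, -, hz⟩ := exists_deriv_zero_between hV' (huq.trans hqv) (hu.trans hv.symm)
  have := hw z
  have := hw (F z)
  have := hpos z
  have := hpos (F z)
  have : 0 < w₂ z * w (F z) + k ^ 2 * w₂ (F z) / w z ^ 3 := by positivity
  exact this.ne' hz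

lemma hasDerivAt_isingF (d : ℕ) {θ : ℝ} (hθ : 0 < θ) (B t : ℝ) :
    HasDerivAt (isingF d θ B)
      (-(((d : ℝ) - 1) * (θ ^ 2 - 1)) / (1 + θ ^ 2 + 2 * θ * Real.cosh t)) t := by
  have he := Real.exp_pos t
  have hN : Real.exp t + θ ≠ 0 := by positivity
  have hD : θ * Real.exp t + 1 ≠ 0 := by positivity
  have h := (((((Real.hasDerivAt_exp t).add_const θ).div
    (((Real.hasDerivAt_exp t).const_mul θ).add_const 1) hD).log
      (div_ne_zero hN hD)).const_mul ((d : ℝ) - 1)).const_add (2 * B)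
  refine h.congr_deriv ?_
  have hcosh : 1 + θ ^ 2 + 2 * θ * Real.cosh t
      = (Real.exp t + θ) * (θ * Real.exp t + 1) / Real.exp t := by
    rw [Real.cosh_eq, Real.exp_neg]
    field_simp
    ring
  rw [hcosh]
  simp only [Pi.div_apply]
  field_simp
  ring

theorem stmt13 (d : ℕ) (hd : 3 ≤ d) (B θ : ℝ) (hθ : 1 < θ) :
    {t : ℝ | isingF d θ B (isingF d θ B t) = t}.encard ≤ 3 := by
  have hθ0 : 0 < θ := by linarith
  have hd' : (3 : ℝ) ≤ d := by exact_mod_cast hd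
  have hD : ∀ t, 0 < 1 + θ ^ 2 + 2 * θ * Real.cosh t := fun t => by
    have := Real.cosh_pos t
    positivity
  have hsq : ∀ t, √(1 + θ ^ 2 + 2 * θ * Real.cosh t) ^ 2 = 1 + θ ^ 2 + 2 * θ * Real.cosh t :=
    fun t => Real.sq_sqrt (hD t).le
  have hw : ∀ t, 0 < √(1 + θ ^ 2 + 2 * θ * Real.cosh t) := fun t => Real.sqrt_pos.2 (hD t)
  have h₁ : ∀ t, HasDerivAt (fun t => √(1 + θ ^ 2 + 2 * θ * Real.cosh t))
      (θ * Real.sinh t / √(1 + θ ^ 2 + 2 * θ * Real.cosh t)) t := fun t => by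
    refine ((((Real.hasDerivAt_cosh t).const_mul (2 * θ)).const_add (1 + θ ^ 2)).sqrt
      (hD t).ne').congr_deriv ?_
    have := (hw t).ne'
    field_simp
  have h₂ : ∀ t, HasDerivAt (fun t => θ * Real.sinh t / √(1 + θ ^ 2 + 2 * θ * Real.cosh t))
      ((θ * Real.cosh t * (1 + θ ^ 2 + 2 * θ * Real.cosh t) - θ ^ 2 * Real.sinh t ^ 2) /
        √(1 + θ ^ 2 + 2 * θ * Real.cosh t) ^ 3) t := fun t => by
    refine (((Real.hasDerivAt_sinh t).const_mul θ).div (h₁ t) (hw t).ne').congr_deriv ?_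
    have hs := (hw t).ne'
    rw [← hsq t]
    simp only [Real.sqrt_sq (Real.sqrt_nonneg _)]
    field_simp
  refine encard_fixedPoints_comp_self_le_three (k := ((d : ℝ) - 1) * (θ ^ 2 - 1))
    (mul_pos (by linarith) (by nlinarith)) hw (fun t => ?_) h₁ h₂ fun t => div_pos ?_ ?_
  · rw [hsq t]
    exact hasDerivAt_isingF d hθ0 B t
  · have hc := Real.cosh_pos t
    rw [Real.sinh_sq]
    have : 0 < θ * Real.cosh t * (1 + θ ^ 2) + θ ^ 2 * Real.cosh t ^ 2 + θ ^ 2 := by positivity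
    linarith
  · exact pow_pos (hw t) 3
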